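/- arXiv:math/0605544 — 7 statements merged into one kernel-verified Lean document; each statement's English description precedes it below -/
import Mathlib

section
/- Let A be a nonzero element of sl(2,ℂ) and let r ∈ ℂ satisfy r² = −4·det A. Then the eigenspace {σ ∈ sl(2,ℂ) : [A,σ] = r·σ} is a one-dimensional complex subspace of sl(2,ℂ). -/
/-- The eigenvector equation for `ad A` on `sl(2,ℂ)`, in coordinates. -/
lemma commutator_eq_smul_iff_entries (a b c x y z s : ℂ) :
    !![a, b; c, -a] * !![x, y; z, -x] - !![x, y; z, -x] * !![a, b; c, -a]
        = (2 * s) • !![x, y; z, -x] ↔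
      b * z - c * y = 2 * s * x ∧ (a - s) * y = b * x ∧ c * x = (a + s) * z := by
  rw [← Matrix.ext_iff]
  simp only [Fin.forall_fin_two, Matrix.mul_fin_two, Matrix.sub_apply, Matrix.smul_apply,
    Matrix.of_apply, Matrix.cons_val', Matrix.cons_val_zero, Matrix.cons_val_one,
    Matrix.cons_val_fin_one, smul_eq_mul]
  constructor
  · rintro ⟨⟨h₁, h₂⟩, h₃, -⟩
    exact ⟨by linear_combination h₁, by linear_combination h₂ / 2, by linear_combination h₃ / 2⟩
  · rintro ⟨h₁, h₂, h₃⟩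
    exact ⟨⟨by linear_combination h₁, by linear_combination 2 * h₂⟩,
      by linear_combination 2 * h₃, by linear_combination -h₁⟩

/-- The coordinate form of the eigenvector equation has a one-dimensional solution space. -/
lemma exists_generator_eigenvector_entries (a b c s : ℂ) (h0 : ¬(a = 0 ∧ b = 0 ∧ c = 0))
    (hs : s ^ 2 = a ^ 2 + b * c) :
    ∃ x₀ y₀ z₀ : ℂ, ¬(x₀ = 0 ∧ y₀ = 0 ∧ z₀ = 0) ∧
      (b * z₀ - c * y₀ = 2 * s * x₀ ∧ (a - s) * y₀ = b * x₀ ∧ c * x₀ = (a + s) * z₀) ∧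
      ∀ x y z : ℂ,
        b * z - c * y = 2 * s * x ∧ (a - s) * y = b * x ∧ c * x = (a + s) * z →
          ∃ k : ℂ, x = k * x₀ ∧ y = k * y₀ ∧ z = k * z₀ := by
  by_cases hb : b = 0
  · by_cases hc : c = 0
    · subst hb hc
      have ha : a ≠ 0 := fun h => h0 ⟨h, rfl, rfl⟩
      have hsa : s = a ∨ s = -a := sq_eq_sq_iff_eq_or_eq_neg.mp (by linear_combination hs)
      rcases hsa with rfl | rfl
      · refine ⟨0, 1, 0, by simp, by simp, fun x y z ⟨h₁, _, h₃⟩ => ⟨y, ?_, by simp, ?_⟩⟩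
        · simpa [ha] using h₁
        · have : s * z = 0 := by linear_combination -h₃ / 2
          simpa [ha] using this
      · refine ⟨0, 0, 1, by simp, by simp, fun x y z ⟨h₁, h₂, _⟩ => ⟨z, ?_, ?_, by simp⟩⟩
        · simpa [ha] using h₁
        · have : a * y = 0 := by linear_combination h₂ / 2
          simpa [ha] using this
    · refine ⟨a + s, -(a + s) ^ 2 / c, c, by simp [hc], ⟨?_, ?_, by ring⟩,
        fun x y z ⟨h₁, _, h₃⟩ => ⟨z / c, ?_, ?_, by field_simp⟩⟩
      · field_simp
        linear_combination -hs
      · field_simp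
        linear_combination (a + s) * hs
      · field_simp
        linear_combination h₃
      · field_simp
        linear_combination -c * h₁ - 2 * s * h₃ - z * hs
  · refine ⟨a - s, b, -(a - s) ^ 2 / b, by simp [hb], ⟨?_, by ring, ?_⟩,
      fun x y z ⟨h₁, h₂, _⟩ => ⟨y / b, ?_, by field_simp, ?_⟩⟩
    · field_simp
      linear_combination hs
    · field_simp
      linear_combination -(a - s) * hs
    · field_simp
      linear_combination -h₂
    · field_simp
      linear_combination b * h₁ - 2 * s * h₂ - y * hs

lemma eq_of_trace_eq_zero_fin_two {M : Matrix (Fin 2) (Fin 2) ℂ} (hM : M.trace = 0) :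
    M = !![M 0 0, M 0 1; M 1 0, -M 0 0] := by
  rw [Matrix.trace_fin_two] at hM
  rw [← eq_neg_of_add_eq_zero_right hM]
  exact Matrix.eta_fin_two M


/-- For a nonzero `A ∈ sl(2,ℂ)` and `r` with `r² = -4 det A`,
the eigenspace `{σ ∈ sl(2,ℂ) : [A,σ] = r·σ}` is one-dimensional: it is spanned by
a single nonzero vector. -/
theorem adjoint_eigenspace_one_dimensional
    (A : Matrix (Fin 2) (Fin 2) ℂ) (hA : A.trace = 0) (hA0 : A ≠ 0)
    (r : ℂ) (hr : r ^ 2 = -4 * A.det) :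
    ∃ σ₀ : Matrix (Fin 2) (Fin 2) ℂ,
      σ₀.trace = 0 ∧ σ₀ ≠ 0 ∧ A * σ₀ - σ₀ * A = r • σ₀ ∧
      ∀ σ : Matrix (Fin 2) (Fin 2) ℂ, σ.trace = 0 → A * σ - σ * A = r • σ →
        ∃ c : ℂ, σ = c • σ₀ := by
  have hAe := eq_of_trace_eq_zero_fin_two hA
  generalize A 0 0 = a, A 0 1 = b, A 1 0 = c at hAe
  subst hAe
  obtain ⟨s, rfl⟩ : ∃ s, r = 2 * s := ⟨r / 2, by ring⟩
  rw [Matrix.det_fin_two_of] at hr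
  obtain ⟨x₀, y₀, z₀, hne, heq, hgen⟩ := exists_generator_eigenvector_entries a b c s
    (by
      rintro ⟨rfl, rfl, rfl⟩
      exact hA0 (by ext i j; fin_cases i <;> fin_cases j <;> simp))
    (by linear_combination hr / 4)
  refine ⟨!![x₀, y₀; z₀, -x₀], by simp [Matrix.trace_fin_two], fun h => hne ?_,
    (commutator_eq_smul_iff_entries ..).mpr heq, fun σ hσ h => ?_⟩
  · exact ⟨by simpa using congrFun₂ h 0 0, by simpa using congrFun₂ h 0 1,
      by simpa using congrFun₂ h 1 0⟩
  · have hσe := eq_of_trace_eq_zero_fin_two hσ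
    rw [hσe, commutator_eq_smul_iff_entries] at h
    obtain ⟨k, hx, hy, hz⟩ := hgen _ _ _ h
    refine ⟨k, ?_⟩
    rw [hσe, hx, hy, hz]
    simp [Matrix.smul_of]
end

section
/- Let A, B ∈ sl(2,ℂ) and let s ∈ ℂ satisfy s² = tr(A²)/2. Then the element σ := tr(A²)·B − tr(AB)·A + s·[A,B] of sl(2,ℂ) satisfies [A,σ] = 2s·σ; that is, σ is an eigenvector (possibly zero) of ad_A with eigenvalue 2s, where (2s)² = 2·tr(A²) = −4·det A. -/
/-- For `A, B ∈ sl(2,ℂ)` and `s` with `s² = tr(A²)/2`, the element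
`σ := tr(A²)·B − tr(AB)·A + s·[A,B]` satisfies `[A,σ] = 2s·σ`, i.e. it is a
(possibly zero) eigenvector of `ad_A` with eigenvalue `2s`, where
`(2s)² = 2·tr(A²) = −4·det A`. -/
theorem sigma_is_adjoint_eigenvector
    (A B : Matrix (Fin 2) (Fin 2) ℂ) (hA : A.trace = 0) (hB : B.trace = 0)
    (s : ℂ) (hs : s ^ 2 = (A * A).trace / 2) :
    A * ((A * A).trace • B - (A * B).trace • A + s • (A * B - B * A)) -
        ((A * A).trace • B - (A * B).trace • A + s • (A * B - B * A)) * A =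
      (2 * s) • ((A * A).trace • B - (A * B).trace • A + s • (A * B - B * A)) ∧
    (2 * s) ^ 2 = 2 * (A * A).trace ∧ (2 * s) ^ 2 = -4 * A.det := by
  have hA' : A 1 1 = -A 0 0 := by
    rw [Matrix.trace_fin_two] at hA
    linear_combination hA
  have hB' : B 1 1 = -B 0 0 := by
    rw [Matrix.trace_fin_two] at hB
    linear_combination hB
  refine ⟨?_, by linear_combination 4 * hs, ?_⟩
  · ext i j
    have key := congrArg (fun x => (A * B - B * A) i j * x) hs
    fin_cases i <;> fin_cases j <;>
      simp [Matrix.trace_fin_two, Matrix.mul_apply, Fin.sum_univ_two, hA', hB',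
        -mul_eq_mul_left_iff] at key ⊢ <;>
      linear_combination (-2) * key
  · simp only [Matrix.trace_fin_two, Matrix.mul_apply, Fin.sum_univ_two, hA'] at hs
    rw [Matrix.det_fin_two, hA']
    linear_combination 4 * hs
end

section
/- Let A be a nonzero element of sl(2,ℂ) and let s ∈ ℂ satisfy s² = tr(A²)/2. Then there exists B ∈ sl(2,ℂ) such that tr(A²)·B − tr(AB)·A + s·[A,B] ≠ 0. -/
/-- For a nonzero `A ∈ sl(2,ℂ)` and `s` with `s² = tr(A²)/2`, there
exists `B ∈ sl(2,ℂ)` such that `tr(A²)·B − tr(AB)·A + s·[A,B] ≠ 0`. -/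
theorem sigma_nonzero_exists
    (A : Matrix (Fin 2) (Fin 2) ℂ) (hA : A.trace = 0) (hA0 : A ≠ 0)
    (s : ℂ) (hs : s ^ 2 = (A * A).trace / 2) :
    ∃ B : Matrix (Fin 2) (Fin 2) ℂ, B.trace = 0 ∧
      (A * A).trace • B - (A * B).trace • A + s • (A * B - B * A) ≠ 0 := by
  by_contra! h
  have hd : A 1 1 = -A 0 0 := by
    rw [Matrix.trace_fin_two] at hA
    linear_combination hA
  have hE := h !![0, 1; 0, 0] (by simp [Matrix.trace_fin_two])
  have hF := h !![0, 0; 1, 0] (by simp [Matrix.trace_fin_two])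
  have hE10 := congrFun (congrFun hE 1) 0
  have hE01 := congrFun (congrFun hE 0) 1
  have hF01 := congrFun (congrFun hF 0) 1
  have hF10 := congrFun (congrFun hF 1) 0
  simp only [Matrix.trace_fin_two, Matrix.mul_apply, Matrix.add_apply, Matrix.sub_apply,
    Matrix.smul_apply, Matrix.zero_apply, Matrix.of_apply, Matrix.cons_val_zero,
    Matrix.cons_val_one, Matrix.cons_val_fin_one, Fin.sum_univ_two, smul_eq_mul, hd]
    at hE10 hE01 hF01 hF10
  have hc : A 1 0 = 0 := pow_eq_zero_iff two_ne_zero |>.mp (by linear_combination -hE10)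
  have hb : A 0 1 = 0 := pow_eq_zero_iff two_ne_zero |>.mp (by linear_combination -hF01)
  have ha : A 0 0 = 0 := by
    rw [hb, hc] at hE01 hF10
    exact pow_eq_zero_iff two_ne_zero |>.mp (by linear_combination (hE01 + hF10) / 4)
  apply hA0
  ext i j
  fin_cases i <;> fin_cases j <;> simp [ha, hd, hb, hc]
end

section
/- Let A⁰, A¹, …, Aⁿ ∈ sl(2,ℂ) and B₀, B₁ ∈ sl(2,ℂ), and let s₀, s₁ ∈ ℂ satisfy s₀² = tr((A⁰)²)/2 and s₁² = tr((Aⁿ⁻¹)²)/2. Set e₋ := tr((A⁰)²)·B₀ − tr(A⁰B₀)·A⁰ − s₀·[A⁰,B₀] and e₊ := tr((Aⁿ⁻¹)²)·B₁ − tr(Aⁿ⁻¹B₁)·Aⁿ⁻¹ + s₁·[Aⁿ⁻¹,B₁], assume e₋ ≠ 0, e₊ ≠ 0, tr(e₋·e₊) ≠ 0 and tr(e₋·Aⁿ) ≠ 0, and let (σ₋, σ₊, σ₃) be the accompanying standard basis σ₋ = e₋/tr(e₋·Aⁿ), σ₊ = e₊·tr(e₋·Aⁿ)/tr(e₋·e₊),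 σ₃ = [e₊,e₋]/tr(e₋·e₊). Then for every g ∈ SL(2,ℂ), the quantities tr(σ₃·Aⁱ)/2, tr(σ₋·Aⁱ) and tr(σ₊·Aⁱ) (for each i) are unchanged when every matrix A⁰,…,Aⁿ, B₀, B₁ is replaced by its conjugate gXg⁻¹ and the basis is rebuilt from the conjugated data; i.e., the coordinates of the Aⁱ in the accompanying basis are invariant under simultaneous SL(2,ℂ) conjugation. -/
/-- The map `σ_s(A,B) := tr(A²)·B − tr(AB)·A + s·[A,B]` on `sl(2,ℂ) × sl(2,ℂ)`. -/
noncomputable def sigmaMap (s : ℂ) (A B : Matrix (Fin 2) (Fin 2) ℂ) : Matrix (Fin 2) (Fin 2) ℂ :=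
  (A * A).trace • B - (A * B).trace • A + s • (A * B - B * A)

/-- The `σ₋` component of the accompanying standard basis of data `(e₋, e₊, V)`. -/
noncomputable def accM (em _ep V : Matrix (Fin 2) (Fin 2) ℂ) : Matrix (Fin 2) (Fin 2) ℂ :=
  ((em * V).trace)⁻¹ • em

/-- The `σ₊` component of the accompanying standard basis of data `(e₋, e₊, V)`. -/
noncomputable def accP (em ep V : Matrix (Fin 2) (Fin 2) ℂ) : Matrix (Fin 2) (Fin 2) ℂ :=
  ((em * V).trace / (em * ep).trace) • ep

/-- The `σ₃` component of the accompanying standard basis of data `(e₋, e₊, V)`. -/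
noncomputable def acc3 (em ep _V : Matrix (Fin 2) (Fin 2) ℂ) : Matrix (Fin 2) (Fin 2) ℂ :=
  ((em * ep).trace)⁻¹ • (ep * em - em * ep)

theorem conj_mul_conj {g : Matrix (Fin 2) (Fin 2) ℂ} (hg : g.det = 1)
    (X Y : Matrix (Fin 2) (Fin 2) ℂ) :
    g * X * g⁻¹ * (g * Y * g⁻¹) = g * (X * Y) * g⁻¹ := by
  have h : g⁻¹ * g = 1 := Matrix.nonsing_inv_mul g (by simp [hg])
  calc g * X * g⁻¹ * (g * Y * g⁻¹) = g * X * (g⁻¹ * g) * Y * g⁻¹ := by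
        simp only [Matrix.mul_assoc]
    _ = g * (X * Y) * g⁻¹ := by rw [h, Matrix.mul_one, Matrix.mul_assoc g]

theorem trace_conj_eq {g : Matrix (Fin 2) (Fin 2) ℂ} (hg : g.det = 1)
    (X : Matrix (Fin 2) (Fin 2) ℂ) : (g * X * g⁻¹).trace = X.trace := by
  rw [Matrix.trace_mul_comm, ← Matrix.mul_assoc, Matrix.nonsing_inv_mul g (by simp [hg]),
    Matrix.one_mul]

theorem sigmaMap_conj {g : Matrix (Fin 2) (Fin 2) ℂ} (hg : g.det = 1) (s : ℂ)
    (X Y : Matrix (Fin 2) (Fin 2) ℂ) :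
    sigmaMap s (g * X * g⁻¹) (g * Y * g⁻¹) = g * sigmaMap s X Y * g⁻¹ := by
  simp only [sigmaMap, conj_mul_conj hg, trace_conj_eq hg, Matrix.mul_add, Matrix.add_mul,
    Matrix.mul_sub, Matrix.sub_mul, Matrix.mul_smul, Matrix.smul_mul]

theorem accM_conj {g : Matrix (Fin 2) (Fin 2) ℂ} (hg : g.det = 1)
    (em ep V : Matrix (Fin 2) (Fin 2) ℂ) :
    accM (g * em * g⁻¹) (g * ep * g⁻¹) (g * V * g⁻¹) = g * accM em ep V * g⁻¹ := by
  simp only [accM, conj_mul_conj hg, trace_conj_eq hg, Matrix.mul_smul, Matrix.smul_mul]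

theorem accP_conj {g : Matrix (Fin 2) (Fin 2) ℂ} (hg : g.det = 1)
    (em ep V : Matrix (Fin 2) (Fin 2) ℂ) :
    accP (g * em * g⁻¹) (g * ep * g⁻¹) (g * V * g⁻¹) = g * accP em ep V * g⁻¹ := by
  simp only [accP, conj_mul_conj hg, trace_conj_eq hg, Matrix.mul_smul, Matrix.smul_mul]

theorem acc3_conj {g : Matrix (Fin 2) (Fin 2) ℂ} (hg : g.det = 1)
    (em ep V : Matrix (Fin 2) (Fin 2) ℂ) :
    acc3 (g * em * g⁻¹) (g * ep * g⁻¹) (g * V * g⁻¹) = g * acc3 em ep V * g⁻¹ := by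
  simp only [acc3, conj_mul_conj hg, trace_conj_eq hg, Matrix.mul_sub, Matrix.sub_mul,
    Matrix.mul_smul, Matrix.smul_mul]

/-- the coordinates `tr(σ₃Aⁱ)/2`, `tr(σ₋Aⁱ)`, `tr(σ₊Aⁱ)` of the
matrices `Aⁱ` in the accompanying standard basis built from
`e₋ = σ_{-s₀}(A⁰, B₀)`, `e₊ = σ_{s₁}(Aⁿ⁻¹, B₁)` and `V = Aⁿ` are invariant under
simultaneous `SL(2,ℂ)`-conjugation of all the data. -/
theorem accompanying_coordinates_invariant
    (n : ℕ) (hn : 2 ≤ n)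
    (A : ℕ → Matrix (Fin 2) (Fin 2) ℂ) (B₀ B₁ : Matrix (Fin 2) (Fin 2) ℂ)
    (hA : ∀ i, i ≤ n → (A i).trace = 0) (hB₀ : B₀.trace = 0) (hB₁ : B₁.trace = 0)
    (s₀ s₁ : ℂ)
    (hs₀ : s₀ ^ 2 = (A 0 * A 0).trace / 2)
    (hs₁ : s₁ ^ 2 = (A (n - 1) * A (n - 1)).trace / 2)
    (em ep : Matrix (Fin 2) (Fin 2) ℂ)
    (hem : em = sigmaMap (-s₀) (A 0) B₀)
    (hep : ep = sigmaMap s₁ (A (n - 1)) B₁)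
    (hem0 : em ≠ 0) (hep0 : ep ≠ 0)
    (hpair : (em * ep).trace ≠ 0) (hVpair : (em * A n).trace ≠ 0)
    (g : Matrix (Fin 2) (Fin 2) ℂ) (hg : g.det = 1)
    (A' : ℕ → Matrix (Fin 2) (Fin 2) ℂ) (B₀' B₁' : Matrix (Fin 2) (Fin 2) ℂ)
    (hA' : ∀ i, A' i = g * A i * g⁻¹)
    (hB₀' : B₀' = g * B₀ * g⁻¹) (hB₁' : B₁' = g * B₁ * g⁻¹)
    (em' ep' : Matrix (Fin 2) (Fin 2) ℂ)
    (hem' : em' = sigmaMap (-s₀) (A' 0) B₀')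
    (hep' : ep' = sigmaMap s₁ (A' (n - 1)) B₁') :
    ∀ i, i ≤ n →
      (acc3 em' ep' (A' n) * A' i).trace / 2 = (acc3 em ep (A n) * A i).trace / 2 ∧
      (accM em' ep' (A' n) * A' i).trace = (accM em ep (A n) * A i).trace ∧
      (accP em' ep' (A' n) * A' i).trace = (accP em ep (A n) * A i).trace := by
  intro i _
  have hm : em' = g * em * g⁻¹ := by rw [hem', hem, hA', hB₀', sigmaMap_conj hg]
  have hp : ep' = g * ep * g⁻¹ := by rw [hep', hep, hA', hB₁', sigmaMap_conj hg]
  simp only [hm, hp, hA', acc3_conj hg, accM_conj hg, accP_conj hg, conj_mul_conj hg,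
    trace_conj_eq hg, and_self]
end

section
/- Let n ≥ 2 and let A⁰, A¹, …, Aⁿ ∈ sl(2,ℂ) be nonzero matrices with A⁰ + A¹ + ⋯ + Aⁿ = 0. Assume there is no invertible g ∈ GL(2,ℂ) such that all the matrices gAᵏg⁻¹ (k = 0,…,n) are simultaneously upper triangular. For each k choose a nonzero σᵏ ∈ sl(2,ℂ) and rₖ ∈ ℂ with [Aᵏ, σᵏ] = rₖ·σᵏ and rₖ² = 2·tr((Aᵏ)²). Then there exist indices i, j ∈ {1,…,n} with i ≠ j such that tr(σ⁰·σⁱ) ≠ 0 and tr(σ⁰·Aʲ) ≠ 0. -/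
section

open Matrix

/-- A traceless matrix commuting with a nonzero traceless `2 × 2` matrix is a multiple of it. -/
theorem exists_eq_smul_of_commute_of_trace_eq_zero {K : Type*} [Field K] [NeZero (2 : K)]
    {X Y : Matrix (Fin 2) (Fin 2) K} (hX : X.trace = 0) (hY : Y.trace = 0) (hX0 : X ≠ 0)
    (h : X * Y - Y * X = 0) : ∃ c : K, Y = c • X := by
  have h2 : (2 : K) ≠ 0 := NeZero.ne 2
  have h00 := congr_fun₂ h 0 0
  have h01 := congr_fun₂ h 0 1
  have h10 := congr_fun₂ h 1 0
  simp only [Matrix.sub_apply, mul_apply, Fin.sum_univ_two, Matrix.zero_apply, trace_fin_two] at *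
  have hX1 : X 1 1 = -X 0 0 := by linear_combination hX
  have hY1 : Y 1 1 = -Y 0 0 := by linear_combination hY
  rw [hX1, hY1] at h01 h10
  have e1 : X 0 0 * Y 0 1 = X 0 1 * Y 0 0 := by
    apply mul_left_cancel₀ h2; linear_combination h01
  have e2 : X 0 0 * Y 1 0 = X 1 0 * Y 0 0 := by
    apply mul_left_cancel₀ h2; linear_combination -h10
  have e3 : X 0 1 * Y 1 0 = X 1 0 * Y 0 1 := by linear_combination h00
  by_cases ha : X 0 0 = 0
  · by_cases hb : X 0 1 = 0
    · have hc : X 1 0 ≠ 0 := by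
        intro hc
        apply hX0
        ext i j
        fin_cases i <;> fin_cases j <;> simp [ha, hb, hc, hX1]
      refine ⟨Y 1 0 / X 1 0, ?_⟩
      ext i j
      fin_cases i <;> fin_cases j <;> simp [hX1, hY1] <;> field_simp <;> grind
    · refine ⟨Y 0 1 / X 0 1, ?_⟩
      ext i j
      fin_cases i <;> fin_cases j <;> simp [hX1, hY1] <;> field_simp <;> grind
  · refine ⟨Y 0 0 / X 0 0, ?_⟩
    ext i j
    fin_cases i <;> fin_cases j <;> simp [hX1, hY1] <;> field_simp <;> grind

/-- Orthogonal isotropic elements of `sl(2)` commute. -/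
theorem commute_of_trace_mul_eq_zero {K : Type*} [Field K] [NeZero (2 : K)]
    {X Y : Matrix (Fin 2) (Fin 2) K} (hX : X.trace = 0) (hY : Y.trace = 0)
    (hXX : (X * X).trace = 0) (hYY : (Y * Y).trace = 0) (hXY : (X * Y).trace = 0) :
    X * Y - Y * X = 0 := by
  have h2 : (2 : K) ≠ 0 := NeZero.ne 2
  simp only [mul_apply, Fin.sum_univ_two, trace_fin_two] at *
  have hX1 : X 1 1 = -X 0 0 := by linear_combination hX
  have hY1 : Y 1 1 = -Y 0 0 := by linear_combination hY
  rw [hX1] at hXX hXY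
  rw [hY1] at hYY hXY
  have e1 : X 0 0 ^ 2 + X 0 1 * X 1 0 = 0 := by
    apply mul_left_cancel₀ h2; linear_combination hXX
  have e2 : Y 0 0 ^ 2 + Y 0 1 * Y 1 0 = 0 := by
    apply mul_left_cancel₀ h2; linear_combination hYY
  have a : X 0 1 * Y 1 0 - Y 0 1 * X 1 0 = 0 := by
    apply pow_eq_zero_iff (two_ne_zero) |>.1
    grind
  have b : X 0 0 * Y 0 1 - X 0 1 * Y 0 0 = 0 := by
    apply pow_eq_zero_iff (two_ne_zero) |>.1
    grind
  have c : X 0 0 * Y 1 0 - X 1 0 * Y 0 0 = 0 := by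
    apply pow_eq_zero_iff (two_ne_zero) |>.1
    grind
  ext i j
  fin_cases i <;> fin_cases j <;> simp [mul_apply, hX1, hY1]
  · linear_combination a
  · linear_combination 2 * b
  · linear_combination -2 * c
  · linear_combination -a

/-- A root vector `S` of `A` in `sl(2)` is isotropic and orthogonal to `A`. -/
theorem trace_mul_self_eq_zero_and_trace_mul_eq_zero {K : Type*} [Field K] [NeZero (2 : K)]
    {A S : Matrix (Fin 2) (Fin 2) K} {r : K} (hA : A.trace = 0) (hA0 : A ≠ 0)
    (hS : S.trace = 0) (h : A * S - S * A = r • S) (hr : r ^ 2 = 2 * (A * A).trace) :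
    (S * S).trace = 0 ∧ (S * A).trace = 0 := by
  by_cases hr0 : r = 0
  · subst hr0
    have hAA : (A * A).trace = 0 := by
      apply mul_left_cancel₀ (NeZero.ne (2 : K))
      rw [← hr]
      ring
    obtain ⟨c, rfl⟩ := exists_eq_smul_of_commute_of_trace_eq_zero hA hS hA0 (by simpa using h)
    simp [hAA]
  · constructor
    · apply mul_left_cancel₀ hr0
      rw [← smul_eq_mul, ← trace_smul, ← smul_mul, ← h, sub_mul, trace_sub,
        trace_mul_cycle S A S, mul_assoc, trace_mul_comm A]
      simp
    · apply mul_left_cancel₀ hr0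
      rw [← smul_eq_mul, ← trace_smul, ← smul_mul, ← h, sub_mul, trace_sub,
        mul_assoc A S A, trace_mul_comm A]
      simp

/-- The orthogonal complement of a nonzero isotropic element of `sl(2)` is triangularizable. -/
theorem exists_isUnit_conj_apply_one_zero_eq_zero {K : Type*} [Field K] [NeZero (2 : K)]
    {S : Matrix (Fin 2) (Fin 2) K} (hS : S.trace = 0) (hS0 : S ≠ 0) (hSS : (S * S).trace = 0) :
    ∃ g : Matrix (Fin 2) (Fin 2) K, IsUnit g ∧
      ∀ A : Matrix (Fin 2) (Fin 2) K, A.trace = 0 → (S * A).trace = 0 →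
        (g * A * g⁻¹) 1 0 = 0 := by
  have h2 : (2 : K) ≠ 0 := NeZero.ne 2
  simp only [mul_apply, Fin.sum_univ_two, trace_fin_two] at *
  have hS1 : S 1 1 = -S 0 0 := by linear_combination hS
  rw [hS1] at hSS
  have e : S 0 0 ^ 2 + S 0 1 * S 1 0 = 0 := by
    apply mul_left_cancel₀ h2; linear_combination hSS
  by_cases hc : S 1 0 = 0
  · have ha : S 0 0 = 0 := by simpa [hc] using e
    have hb : S 0 1 ≠ 0 := by
      intro hb
      apply hS0
      ext i j
      fin_cases i <;> fin_cases j <;> simp [ha, hb, hc, hS1]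
    refine ⟨1, isUnit_one, fun A _ h => ?_⟩
    simpa [ha, hb, hc, hS1] using h
  · have hdet : (!![0, 1; S 1 0, -S 0 0] : Matrix (Fin 2) (Fin 2) K).det = -S 1 0 := by
      simp [det_fin_two]
    refine ⟨!![0, 1; S 1 0, -S 0 0], ?_, fun A hA h => ?_⟩
    · rw [isUnit_iff_isUnit_det, hdet]
      exact (neg_ne_zero.2 hc).isUnit
    · have hA1 : A 1 1 = -A 0 0 := by linear_combination hA
      rw [hA1, hS1] at h
      rw [inv_def, hdet, adjugate_fin_two]
      simp [hA1]
      field_simp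
      grind

end

open Finset in
/-- for a non-simultaneously-triangularizable family of nonzero
`A⁰,…,Aⁿ ∈ sl(2,ℂ)` with zero sum, and chosen nonzero eigenvectors
`σᵏ` of `ad_{Aᵏ}` with eigenvalues `rₖ`, `rₖ² = 2·tr((Aᵏ)²)`, there exist distinct
indices `i, j ∈ {1,…,n}` with `tr(σ⁰σⁱ) ≠ 0` and `tr(σ⁰Aʲ) ≠ 0`. -/
theorem chart_exists
    (n : ℕ) (hn : 2 ≤ n)
    (A : Fin (n + 1) → Matrix (Fin 2) (Fin 2) ℂ)
    (hAtr : ∀ k, (A k).trace = 0) (hA0 : ∀ k, A k ≠ 0)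
    (hsum : ∑ k, A k = 0)
    (htri : ¬ ∃ g : Matrix (Fin 2) (Fin 2) ℂ, IsUnit g ∧
      ∀ k, (g * A k * g⁻¹) 1 0 = 0)
    (σ : Fin (n + 1) → Matrix (Fin 2) (Fin 2) ℂ) (r : Fin (n + 1) → ℂ)
    (hσtr : ∀ k, (σ k).trace = 0) (hσ0 : ∀ k, σ k ≠ 0)
    (heig : ∀ k, A k * σ k - σ k * A k = r k • σ k)
    (hr : ∀ k, r k ^ 2 = 2 * (A k * A k).trace) :
    ∃ i j : Fin (n + 1), i ≠ 0 ∧ j ≠ 0 ∧ i ≠ j ∧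
      (σ 0 * σ i).trace ≠ 0 ∧ (σ 0 * A j).trace ≠ 0 := by
  have hroot k := trace_mul_self_eq_zero_and_trace_mul_eq_zero
    (hAtr k) (hA0 k) (hσtr k) (heig k) (hr k)
  have key : ∀ k, (σ 0 * A k).trace ≠ 0 → (σ 0 * σ k).trace ≠ 0 := by
    intro k hk h
    obtain ⟨c, hc⟩ := exists_eq_smul_of_commute_of_trace_eq_zero (hσtr k) (hσtr 0) (hσ0 k)
      (commute_of_trace_mul_eq_zero (hσtr k) (hσtr 0) (hroot k).1 (hroot 0).1
        (by rwa [Matrix.trace_mul_comm]))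
    apply hk
    rw [hc]
    simp [(hroot k).2]
  obtain ⟨i, hi⟩ : ∃ i, (σ 0 * A i).trace ≠ 0 := by
    by_contra! h
    obtain ⟨g, hg, hgA⟩ :=
      exists_isUnit_conj_apply_one_zero_eq_zero (hσtr 0) (hσ0 0) (hroot 0).1
    exact htri ⟨g, hg, fun k => hgA _ (hAtr k) (h k)⟩
  have hzero : ∑ k, (σ 0 * A k).trace = 0 := by
    rw [← Matrix.trace_sum, ← Finset.mul_sum, hsum]
    simp
  obtain ⟨j, hji, hj⟩ : ∃ j, j ≠ i ∧ (σ 0 * A j).trace ≠ 0 := by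
    by_contra! h
    exact hi (by rwa [Fintype.sum_eq_single i h] at hzero)
  have hne : ∀ k, (σ 0 * A k).trace ≠ 0 → k ≠ 0 := by
    rintro _ hk rfl
    exact hk (hroot 0).2
  exact ⟨i, j, hne i hi, hne j hj, hji.symm, key i hi, hj⟩
end

section
/- Let A⁰, …, Aⁿ and B⁰, …, Bⁿ be elements of sl(2,ℂ), and assume the family (A⁰,…,Aⁿ) is not simultaneously upper-triangularizable (no invertible g ∈ GL(2,ℂ) makes all gAⁱg⁻¹ upper triangular). If tr(Aⁱ·Aʲ) = tr(Bⁱ·Bʲ) for all i, j and tr([Aⁱ,Aʲ]·Aᵏ) = tr([Bⁱ,Bʲ]·Bᵏ) for all i, j, k, then there exists g ∈ SL(2,ℂ) such that Bⁱ = gAⁱg⁻¹ for every i; i.e., the invariants a_{ij} = ⟨Aⁱ,Aʲ⟩ and f_{ijk} = ⟨[Aⁱ,Aʲ],Aᵏ⟩ characterize such a family up to the action of SL(2,ℂ). -/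
open Matrix

/-- Every algebra automorphism of a full matrix algebra over a field is inner. -/
theorem Matrix.exists_isUnit_det_algEquiv_apply_mul {K ι : Type*} [Field K] [Fintype ι]
    [DecidableEq ι] (φ : Matrix ι ι K ≃ₐ[K] Matrix ι ι K) :
    ∃ g : Matrix ι ι K, IsUnit g.det ∧ ∀ M, φ M * g = g * M := by
  obtain ⟨T, hT⟩ := AlgEquiv.eq_linearEquivConjAlgEquiv
    ((Matrix.toLinAlgEquiv' (R := K) (n := ι)).symm.trans (φ.trans Matrix.toLinAlgEquiv'))
  refine ⟨LinearMap.toMatrix' T.toLinearMap, ?_, fun M => ?_⟩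
  · rw [LinearMap.det_toMatrix']
    exact LinearEquiv.isUnit_det' T
  · have h := DFunLike.congr_fun hT (Matrix.toLinAlgEquiv' M)
    apply Matrix.toLin'.injective
    ext1 v
    have h' := LinearMap.congr_fun h (T (Pi.single v 1))
    simp only [AlgEquiv.trans_apply, AlgEquiv.symm_apply_apply, LinearEquiv.conjAlgEquiv_apply,
      LinearMap.comp_apply, LinearEquiv.coe_coe, LinearEquiv.symm_apply_apply] at h'
    ext1
    simpa [Matrix.toLin'_mul, Matrix.toLin'_toMatrix'] using h'

/-- Over an algebraically closed field, an invertible matrix of size two can be rescaled to have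
determinant one. -/
theorem Matrix.exists_smul_det_eq_one {K : Type*} [Field K] [IsAlgClosed K]
    {g : Matrix (Fin 2) (Fin 2) K} (hg : g.det ≠ 0) : ∃ c : K, (c • g).det = 1 := by
  obtain ⟨z, hz⟩ := IsAlgClosed.exists_eq_mul_self (g.det)⁻¹
  refine ⟨z, ?_⟩
  rw [Matrix.det_smul, Fintype.card_fin, pow_two, ← hz, inv_mul_cancel₀ hg]

/-- Trace-free matrices `X₀, X₁, X₂` of size two with `tr (X₀ X₁ X₂) ≠ 0` form, together with the
identity, a linearly independent family. -/
theorem Matrix.linearIndependent_cons_one {K : Type*} [Field K] [CharZero K]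
    {X : Fin 3 → Matrix (Fin 2) (Fin 2) K} (hX : ∀ a, (X a).trace = 0)
    (hne : (X 0 * X 1 * X 2).trace ≠ 0) : LinearIndependent K (vecCons 1 X : Fin 4 → _) := by
  have h0 := hX 0
  have h1 := hX 1
  have h2 := hX 2
  simp only [trace_fin_two, ← eq_neg_iff_add_eq_zero] at h0 h1 h2
  rw [Fintype.linearIndependent_iff]
  intro c hc
  have e00 := congrFun (congrFun hc 0) 0
  have e01 := congrFun (congrFun hc 0) 1
  have e10 := congrFun (congrFun hc 1) 0
  have e11 := congrFun (congrFun hc 1) 1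
  simp only [Fin.sum_univ_four, cons_val_zero, cons_val_one, cons_val, add_apply, smul_apply,
    smul_eq_mul, one_apply_eq, zero_apply, h0, h1, h2, one_apply_ne zero_ne_one,
    one_apply_ne one_ne_zero] at e00 e01 e10 e11
  have c0 : c 0 = 0 := mul_left_cancel₀ two_ne_zero (by linear_combination e00 + e11)
  have ed : c 1 * X 0 1 1 + c 2 * X 1 1 1 + c 3 * X 2 1 1 = 0 := by
    linear_combination e11 - c0
  simp only [trace_fin_two, mul_apply, Fin.sum_univ_two, h0, h1, h2] at hne
  have c1 : c 1 = 0 := (mul_eq_zero_iff_right hne).mp (by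
    linear_combination -(X 1 0 1 * X 2 1 0 - X 2 0 1 * X 1 1 0) * ed
      - (X 1 1 0 * X 2 1 1 - X 2 1 0 * X 1 1 1) * e01
      - (X 1 1 1 * X 2 0 1 - X 2 1 1 * X 1 0 1) * e10)
  have c2 : c 2 = 0 := (mul_eq_zero_iff_right hne).mp (by
    linear_combination -(X 2 0 1 * X 0 1 0 - X 0 0 1 * X 2 1 0) * ed
      - (X 2 1 0 * X 0 1 1 - X 0 1 0 * X 2 1 1) * e01
      - (X 2 1 1 * X 0 0 1 - X 0 1 1 * X 2 0 1) * e10)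
  have c3 : c 3 = 0 := (mul_eq_zero_iff_right hne).mp (by
    linear_combination -(X 0 0 1 * X 1 1 0 - X 1 0 1 * X 0 1 0) * ed
      - (X 0 1 0 * X 1 1 1 - X 1 1 0 * X 0 1 1) * e01
      - (X 0 1 1 * X 1 0 1 - X 1 1 1 * X 0 0 1) * e10)
  intro p
  fin_cases p
  exacts [c0, c1, c2, c3]

/-- The traces of triple products of three trace-free matrices of size two are determined by a
single one of them, because they alternate. -/
theorem Matrix.trace_mul_mul_eq_of_fin_three {K : Type*} [Field K]
    {X Y : Fin 3 → Matrix (Fin 2) (Fin 2) K}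
    (hX : ∀ a, (X a).trace = 0) (hY : ∀ a, (Y a).trace = 0)
    (hf : (X 0 * X 1 * X 2).trace = (Y 0 * Y 1 * Y 2).trace) (a b c : Fin 3) :
    (X a * X b * X c).trace = (Y a * Y b * Y c).trace := by
  have hX0 := hX 0
  have hX1 := hX 1
  have hX2 := hX 2
  have hY0 := hY 0
  have hY1 := hY 1
  have hY2 := hY 2
  simp only [Matrix.trace_fin_two, ← eq_neg_iff_add_eq_zero] at hX0 hX1 hX2 hY0 hY1 hY2
  simp only [Matrix.trace_fin_two, Matrix.mul_apply, Fin.sum_univ_two, hX0, hX1, hX2,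
    hY0, hY1, hY2] at hf
  fin_cases a <;> fin_cases b <;> fin_cases c <;>
    simp only [Matrix.trace_fin_two, Matrix.mul_apply, Fin.sum_univ_two, hX0, hX1, hX2,
      hY0, hY1, hY2, Fin.zero_eta, Fin.mk_one, Fin.reduceFinMk] <;>
    first | linear_combination hf | linear_combination -hf | ring1

/-- Two triples of trace-free matrices with the same nondegenerate trace invariants are conjugate,
and the conjugating matrix carries along every trace-free matrix according to its trace pairings
with the triple. -/
theorem Matrix.exists_conj_of_trace_eq {K : Type*} [Field K] [IsAlgClosed K] [CharZero K]
    {X Y : Fin 3 → Matrix (Fin 2) (Fin 2) K}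
    (hX : ∀ a, (X a).trace = 0) (hY : ∀ a, (Y a).trace = 0)
    (ha : ∀ a b, (X a * X b).trace = (Y a * Y b).trace)
    (hf : (X 0 * X 1 * X 2).trace = (Y 0 * Y 1 * Y 2).trace)
    (hne : (X 0 * X 1 * X 2).trace ≠ 0) :
    ∃ g : Matrix (Fin 2) (Fin 2) K, g.det = 1 ∧ ∀ M N : Matrix (Fin 2) (Fin 2) K,
      M.trace = 0 → N.trace = 0 → (∀ a, (M * X a).trace = (N * Y a).trace) →
      N = g * M * g⁻¹ := by
  have hcard : Fintype.card (Fin 4) = Module.finrank K (Matrix (Fin 2) (Fin 2) K) := by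
    simp [Module.finrank_matrix]
  let b := basisOfLinearIndependentOfCardEqFinrank (linearIndependent_cons_one hX hne) hcard
  let b' := basisOfLinearIndependentOfCardEqFinrank
    (linearIndependent_cons_one hY (hf ▸ hne)) hcard
  have hb0 : b 0 = 1 := by simp [b]
  have hb : ∀ a : Fin 3, b a.succ = X a := fun a => by simp [b]
  have hb0' : b' 0 = 1 := by simp [b']
  have hb' : ∀ a : Fin 3, b' a.succ = Y a := fun a => by simp [b']
  let ψ := b.equiv b' (Equiv.refl _)
  have hψ : ∀ p, ψ (b p) = b' p := fun p => by simp [ψ]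
  have ext_b' : ∀ M N : Matrix (Fin 2) (Fin 2) K, M.trace = N.trace →
      (∀ a, (M * Y a).trace = (N * Y a).trace) → M = N := by
    intro M N h0 h
    rw [Matrix.ext_iff_trace_mul_right]
    intro P
    have : (Matrix.traceLinearMap (Fin 2) K K) ∘ₗ LinearMap.mulLeft K M
        = (Matrix.traceLinearMap (Fin 2) K K) ∘ₗ LinearMap.mulLeft K N := by
      refine b'.ext fun p => ?_
      refine Fin.cases ?_ (fun a => ?_) p
      · simpa [hb0'] using h0
      · simpa [hb'] using h a
    simpa using LinearMap.congr_fun this P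
  have hpair : ∀ M p, (ψ M * b' p).trace = (M * b p).trace := by
    intro M p
    have : (Matrix.traceLinearMap (Fin 2) K K) ∘ₗ LinearMap.mulRight K (b' p) ∘ₗ ψ.toLinearMap
        = (Matrix.traceLinearMap (Fin 2) K K) ∘ₗ LinearMap.mulRight K (b p) := by
      refine b.ext fun q => ?_
      simp only [LinearMap.comp_apply, LinearEquiv.coe_coe, hψ, LinearMap.mulRight_apply,
        Matrix.traceLinearMap_apply]
      refine Fin.cases ?_ (fun a => ?_) p <;> refine Fin.cases ?_ (fun c => ?_) q <;>
        simp [hb0, hb0', hb, hb', hX, hY, ha]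
    simpa using LinearMap.congr_fun this M
  have htr : ∀ M, (ψ M).trace = M.trace := fun M => by simpa [hb0, hb0'] using hpair M 0
  have hpairX : ∀ M a, (ψ M * Y a).trace = (M * X a).trace := fun M a => by
    simpa [hb, hb'] using hpair M a.succ
  have hψ1 : ψ 1 = 1 := by rw [← hb0, hψ, hb0', hb0]
  have hψX : ∀ a, ψ (X a) = Y a := fun a => by rw [← hb, hψ, hb']
  have hmulX : ∀ a c, ψ (X a * X c) = Y a * Y c := fun a c =>
    ext_b' _ _ (by rw [htr, ha]) fun d => by
      rw [hpairX, Matrix.trace_mul_mul_eq_of_fin_three hX hY hf]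
  have hmul : ∀ M N, ψ (M * N) = ψ M * ψ N := by
    have : (LinearMap.mul K (Matrix (Fin 2) (Fin 2) K)).compr₂ ψ.toLinearMap
        = (LinearMap.mul K (Matrix (Fin 2) (Fin 2) K)).compl₁₂ ψ.toLinearMap ψ.toLinearMap := by
      refine b.ext fun p => b.ext fun q => ?_
      refine Fin.cases ?_ (fun a => ?_) p <;> refine Fin.cases ?_ (fun c => ?_) q <;>
        simp [hb0, hb, hψ1, hψX, hmulX]
    intro M N
    simpa using LinearMap.congr_fun (LinearMap.congr_fun this M) N
  obtain ⟨g, hg, hgM⟩ :=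
    Matrix.exists_isUnit_det_algEquiv_apply_mul (AlgEquiv.ofLinearEquiv ψ hψ1 hmul)
  obtain ⟨z, hz⟩ := Matrix.exists_smul_det_eq_one hg.ne_zero
  refine ⟨z • g, hz, fun M N hM hN h => ?_⟩
  have hN' : ψ M = N := ext_b' _ _ (by rw [htr, hM, hN]) fun a => by rw [hpairX, h]
  have h2 : N * g = g * M := hN' ▸ hgM M
  have h3 : z • g * M = N * (z • g) := by rw [Matrix.smul_mul, ← h2, Matrix.mul_smul]
  rw [h3, Matrix.mul_nonsing_inv_cancel_right]
  simp [hz]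

/-- Matrices of size two with a common eigenvector are simultaneously triangularizable. -/
theorem Matrix.exists_conj_apply_one_zero_eq_zero {K ι : Type*} [Field K]
    {A : ι → Matrix (Fin 2) (Fin 2) K} {v : Fin 2 → K} (hv : v ≠ 0)
    (h : ∀ i, ∃ μ : K, A i *ᵥ v = μ • v) :
    ∃ g : Matrix (Fin 2) (Fin 2) K, IsUnit g ∧ ∀ i, (g * A i * g⁻¹) 1 0 = 0 := by
  obtain ⟨r, s, hrs⟩ : ∃ r s : K, r * v 0 + s * v 1 = 1 := by
    by_cases h0 : v 0 = 0
    · have h1 : v 1 ≠ 0 := fun h1 => hv (by ext i; fin_cases i <;> simp [h0, h1])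
      exact ⟨0, (v 1)⁻¹, by simp [h1]⟩
    · exact ⟨(v 0)⁻¹, 0, by simp [h0]⟩
  have hdet : (!![r, s; -v 1, v 0]).det = 1 := by
    rw [Matrix.det_fin_two_of]
    linear_combination hrs
  refine ⟨!![r, s; -v 1, v 0], by rw [Matrix.isUnit_iff_isUnit_det, hdet]; exact isUnit_one,
    fun i => ?_⟩
  obtain ⟨μ, hμ⟩ := h i
  have e0 := congrFun hμ 0
  have e1 := congrFun hμ 1
  simp only [Matrix.mulVec, dotProduct, Fin.sum_univ_two, Pi.smul_apply, smul_eq_mul] at e0 e1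
  rw [Matrix.inv_def, hdet]
  simp [Matrix.adjugate_fin_two, Matrix.mul_apply, Matrix.vecMul, dotProduct,
    Fin.sum_univ_two]
  linear_combination v 0 * e1 - v 1 * e0

/-- In dimension two, a nonzero trace-free matrix has at most one eigenline for each eigenvalue. -/
theorem Matrix.exists_smul_eq_of_mulVec_eq {K : Type*} [Field K] [CharZero K]
    {C : Matrix (Fin 2) (Fin 2) K} (hC : C ≠ 0) (htr : C.trace = 0) {v w : Fin 2 → K}
    (hv : v ≠ 0) {t : K} (h : C *ᵥ v = t • v) (h' : C *ᵥ w = t • w) :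
    ∃ μ : K, w = μ • v := by
  have hdep : v 0 * w 1 = v 1 * w 0 := by
    by_contra hne
    have hd : v 0 * w 1 - v 1 * w 0 ≠ 0 := sub_ne_zero.mpr hne
    have e0 := congrFun h 0
    have e1 := congrFun h 1
    have e0' := congrFun h' 0
    have e1' := congrFun h' 1
    simp only [Matrix.mulVec, dotProduct, Fin.sum_univ_two, Pi.smul_apply, smul_eq_mul]
      at e0 e1 e0' e1'
    rw [Matrix.trace_fin_two] at htr
    have h01 : C 0 1 = 0 := (mul_eq_zero_iff_right hd).mp (by
      linear_combination v 0 * e0' - w 0 * e0)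
    have h10 : C 1 0 = 0 := (mul_eq_zero_iff_right hd).mp (by
      linear_combination w 1 * e1 - v 1 * e1')
    have h00 : C 0 0 = t := sub_eq_zero.mp ((mul_eq_zero_iff_right hd).mp (by
      linear_combination w 1 * e0 - v 1 * e0'))
    have h11 : C 1 1 = t := sub_eq_zero.mp ((mul_eq_zero_iff_right hd).mp (by
      linear_combination v 0 * e1' - w 0 * e1))
    have ht : t = 0 := by
      rw [h00, h11, ← two_mul] at htr
      simpa using htr
    apply hC
    ext i j
    fin_cases i <;> fin_cases j <;> simp [h00, h01, h10, h11, ht]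
  by_cases h0 : v 0 = 0
  · have h1 : v 1 ≠ 0 := fun h1 => hv (by ext i; fin_cases i <;> simp [h0, h1])
    refine ⟨w 1 / v 1, ?_⟩
    ext i
    fin_cases i
    · simpa [h0, h1] using hdep
    · simp [h1]
  · refine ⟨w 0 / v 0, ?_⟩
    ext i
    fin_cases i
    · simp [h0]
    · simp only [Fin.mk_one, Pi.smul_apply, smul_eq_mul]
      field_simp
      linear_combination hdep

theorem Matrix.exists_mulVec_eq_smul {K : Type*} [Field K] [IsAlgClosed K]
    (C : Matrix (Fin 2) (Fin 2) K) : ∃ v : Fin 2 → K, v ≠ 0 ∧ ∃ t : K, C *ᵥ v = t • v := by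
  obtain ⟨t, ht⟩ := Module.End.exists_eigenvalue (Matrix.toLin' C)
  obtain ⟨v, hv⟩ := ht.exists_hasEigenvector
  exact ⟨v, hv.2, t, by simpa using hv.apply_eq_smul⟩

/-- A family of trace-free matrices of size two is simultaneously triangularizable as soon as all
the invariants `tr ([Aᵢ, Aⱼ] ^ 2)` and `tr ([Aᵢ, Aⱼ] Aₖ)` vanish. -/
theorem Matrix.exists_conj_upper_of_trace_eq_zero {K ι : Type*} [Field K] [IsAlgClosed K]
    [CharZero K] {A : ι → Matrix (Fin 2) (Fin 2) K} (hA : ∀ i, (A i).trace = 0)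
    (hsq : ∀ i j, ((A i * A j - A j * A i) * (A i * A j - A j * A i)).trace = 0)
    (hf : ∀ i j k, ((A i * A j - A j * A i) * A k).trace = 0) :
    ∃ g : Matrix (Fin 2) (Fin 2) K, IsUnit g ∧ ∀ i, (g * A i * g⁻¹) 1 0 = 0 := by
  by_cases hcomm : ∀ i j, A i * A j = A j * A i
  · by_cases hzero : ∀ i, A i = 0
    · exact ⟨1, isUnit_one, fun i => by simp [hzero i]⟩
    push Not at hzero
    obtain ⟨k, hk⟩ := hzero
    obtain ⟨v, hv, t, ht⟩ := (A k).exists_mulVec_eq_smul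
    refine exists_conj_apply_one_zero_eq_zero hv fun i =>
      exists_smul_eq_of_mulVec_eq hk (hA k) hv ht ?_
    rw [mulVec_mulVec, hcomm, ← mulVec_mulVec, ht, mulVec_smul]
  · push Not at hcomm
    obtain ⟨i, j, hij⟩ := hcomm
    set C := A i * A j - A j * A i with hCdef
    have hC : C ≠ 0 := sub_ne_zero.mpr hij
    have hCtr : C.trace = 0 := by rw [hCdef, trace_sub, trace_mul_comm, sub_self]
    have hCsq : (C * C).trace = 0 := hsq i j
    have hdet : C.det = 0 := by
      rw [trace_fin_two] at hCtr hCsq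
      simp only [mul_apply, Fin.sum_univ_two] at hCsq
      have : 2 * C.det = 0 := by
        rw [det_fin_two]
        linear_combination (C 0 0 + C 1 1) * hCtr - hCsq
      simpa using this
    obtain ⟨v, hv, ht⟩ := exists_mulVec_eq_zero_iff.mpr hdet
    refine exists_conj_apply_one_zero_eq_zero hv fun k =>
      exists_smul_eq_of_mulVec_eq (t := 0) hC hCtr hv (by simpa using ht) ?_
    have hanti : C * A k = -(A k * C) := by
      have h1 := hf i j k
      rw [← hCdef] at h1
      have h2 := hA k
      rw [trace_fin_two] at hCtr h1 h2
      simp only [mul_apply, Fin.sum_univ_two] at h1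
      ext p q
      fin_cases p <;> fin_cases q <;>
        simp only [mul_apply, Fin.sum_univ_two, neg_apply, Fin.zero_eta, Fin.mk_one]
      · linear_combination h1 + C 0 0 * h2 - A k 1 1 * hCtr
      · linear_combination C 0 1 * h2 + A k 0 1 * hCtr
      · linear_combination C 1 0 * h2 + A k 1 0 * hCtr
      · linear_combination h1 + C 1 1 * h2 - A k 0 0 * hCtr
    rw [mulVec_mulVec, hanti, neg_mulVec, ← mulVec_mulVec, ht]
    simp

theorem Matrix.trace_commutator_mul {K : Type*} [Field K] {P Q R : Matrix (Fin 2) (Fin 2) K}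
    (hP : P.trace = 0) (hQ : Q.trace = 0) (hR : R.trace = 0) :
    ((P * Q - Q * P) * R).trace = 2 * (P * Q * R).trace := by
  simp only [trace_fin_two, ← eq_neg_iff_add_eq_zero] at hP hQ hR
  simp only [trace_fin_two, mul_apply, Matrix.sub_apply, Fin.sum_univ_two, hP, hQ, hR]
  ring

theorem Matrix.trace_commutator_mul_self {K : Type*} [Field K] {P Q : Matrix (Fin 2) (Fin 2) K}
    (hP : P.trace = 0) (hQ : Q.trace = 0) :
    ((P * Q - Q * P) * (P * Q - Q * P)).trace
      = 2 * (P * Q).trace ^ 2 - 2 * (P * P).trace * (Q * Q).trace := by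
  simp only [trace_fin_two, ← eq_neg_iff_add_eq_zero] at hP hQ
  simp only [trace_fin_two, mul_apply, Matrix.sub_apply, Fin.sum_univ_two, hP, hQ]
  ring

theorem Matrix.trace_commutator {K ι : Type*} [CommRing K] [Fintype ι] (P Q : Matrix ι ι K) :
    (P * Q - Q * P).trace = 0 := by
  rw [trace_sub, trace_mul_comm, sub_self]


/-- for a non-simultaneously-triangularizable family
`A⁰,…,Aⁿ ∈ sl(2,ℂ)`, the invariants `a_{ij} = tr(AⁱAʲ)` and
`f_{ijk} = tr([Aⁱ,Aʲ]Aᵏ)` characterize the family up to `SL(2,ℂ)`-conjugation: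
any family `B⁰,…,Bⁿ ⊂ sl(2,ℂ)` with the same invariants is a simultaneous
`SL(2,ℂ)`-conjugate of it. -/
theorem invariants_characterize_family
    (n : ℕ)
    (A B : Fin (n + 1) → Matrix (Fin 2) (Fin 2) ℂ)
    (hAtr : ∀ i, (A i).trace = 0) (hBtr : ∀ i, (B i).trace = 0)
    (htri : ¬ ∃ g : Matrix (Fin 2) (Fin 2) ℂ, IsUnit g ∧
      ∀ i, (g * A i * g⁻¹) 1 0 = 0)
    (ha : ∀ i j, (A i * A j).trace = (B i * B j).trace)
    (hf : ∀ i j k, ((A i * A j - A j * A i) * A k).trace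
                 = ((B i * B j - B j * B i) * B k).trace) :
    ∃ g : Matrix (Fin 2) (Fin 2) ℂ, g.det = 1 ∧ ∀ i, B i = g * A i * g⁻¹ := by
  have hmul : ∀ i j k, (A i * A j * A k).trace = (B i * B j * B k).trace := fun i j k => by
    have h := hf i j k
    rw [trace_commutator_mul (hAtr i) (hAtr j) (hAtr k),
      trace_commutator_mul (hBtr i) (hBtr j) (hBtr k)] at h
    exact mul_left_cancel₀ two_ne_zero h
  have hsq : ∀ i j, ((A i * A j - A j * A i) * (A i * A j - A j * A i)).trace
      = ((B i * B j - B j * B i) * (B i * B j - B j * B i)).trace := fun i j => by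
    rw [trace_commutator_mul_self (hAtr i) (hAtr j), trace_commutator_mul_self (hBtr i) (hBtr j),
      ha, ha, ha]
  by_cases h3 : ∃ i j k, (A i * A j * A k).trace ≠ 0
  · obtain ⟨i, j, k, hne⟩ := h3
    obtain ⟨g, hg, hconj⟩ := exists_conj_of_trace_eq (X := fun a => A (![i, j, k] a))
      (Y := fun a => B (![i, j, k] a)) (fun _ => hAtr _) (fun _ => hBtr _) (fun _ _ => ha _ _)
      (hmul _ _ _) hne
    exact ⟨g, hg, fun l => hconj _ _ (hAtr l) (hBtr l) fun _ => ha _ _⟩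
  push Not at h3
  have hf0 : ∀ i j k, ((A i * A j - A j * A i) * A k).trace = 0 := fun i j k => by
    rw [trace_commutator_mul (hAtr i) (hAtr j) (hAtr k), h3, mul_zero]
  obtain ⟨i, j, hne⟩ : ∃ i j, ((A i * A j - A j * A i) * (A i * A j - A j * A i)).trace ≠ 0 := by
    by_contra! h
    exact htri (exists_conj_upper_of_trace_eq_zero hAtr h hf0)
  have hlast : ∀ l, (A l * (A i * A j - A j * A i)).trace
      = (B l * (B i * B j - B j * B i)).trace := fun l => by
    rw [trace_mul_comm, hf, trace_mul_comm]
  have htriple : ∀ {P Q : Matrix (Fin 2) (Fin 2) ℂ}, P.trace = 0 → Q.trace = 0 →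
      2 * (P * Q * (P * Q - Q * P)).trace = ((P * Q - Q * P) * (P * Q - Q * P)).trace :=
    fun hP hQ => (trace_commutator_mul hP hQ (trace_commutator _ _)).symm
  obtain ⟨g, hg, hconj⟩ := exists_conj_of_trace_eq (X := ![A i, A j, A i * A j - A j * A i])
    (Y := ![B i, B j, B i * B j - B j * B i])
    (by simp [Fin.forall_fin_succ, hAtr, trace_commutator, -trace_sub])
    (by simp [Fin.forall_fin_succ, hBtr, trace_commutator, -trace_sub])
    (by
      simp only [Fin.forall_fin_succ, IsEmpty.forall_iff, and_true, cons_val_zero, cons_val_succ]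
      exact ⟨⟨ha _ _, ha _ _, hlast _⟩, ⟨ha _ _, ha _ _, hlast _⟩, hf _ _ _, hf _ _ _, hsq _ _⟩)
    (mul_left_cancel₀ two_ne_zero <|
      (htriple (hAtr i) (hAtr j)).trans <| (hsq i j).trans (htriple (hBtr i) (hBtr j)).symm)
    (fun h => hne <| by
      rw [← htriple (hAtr i) (hAtr j)]
      exact mul_eq_zero_of_right _ h)
  refine ⟨g, hg, fun l => hconj _ _ (hAtr l) (hBtr l) ?_⟩
  simp only [Fin.forall_fin_succ, IsEmpty.forall_iff, and_true, cons_val_zero, cons_val_succ]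
  exact ⟨ha _ _, ha _ _, hlast _⟩
end

section
/- Let I ⊆ ℝ be an interval, let λ₀, …, λₙ : I → ℂ be differentiable functions with λᵢ(t) ≠ λₖ(t) for all i ≠ k and t ∈ I, and let A⁰, …, Aⁿ : I → sl(2,ℂ) be differentiable functions satisfying the Schlesinger equations along this curve: (Aᵏ)′(t) = Σ_{i ≠ k} [Aⁱ(t), Aᵏ(t)] · (λᵢ′(t) − λₖ′(t)) / (λᵢ(t) − λₖ(t)) for every k. Then for each k the function t ↦ tr((Aᵏ(t))²) is constant on I; i.e., the quantities a_{kk} = ⟨Aᵏ, Aᵏ⟩ = −2 det Aᵏ are conserved by the Schlesinger flow. -/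
/-- The trace pairing of a matrix with any of its commutators vanishes. -/
theorem Matrix.trace_commutator_mul_self_s14 {ι R : Type*} [Fintype ι] [CommRing R]
    (A B : Matrix ι ι R) : ((B * A - A * B) * A).trace = 0 := by
  rw [sub_mul, Matrix.trace_sub, sub_eq_zero, Matrix.mul_assoc A B A, Matrix.trace_mul_comm A]

/-- The derivative of `tr (M²)` is `2 tr (M' M)`. -/
theorem Matrix.hasDerivAt_trace_mul_self {ι : Type*} [Fintype ι]
    {M : ℝ → Matrix ι ι ℂ} {M' : Matrix ι ι ℂ} {t : ℝ}
    (h : ∀ a b, HasDerivAt (fun u => M u a b) (M' a b) t) :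
    HasDerivAt (fun u => (M u * M u).trace) (2 * (M' * M t).trace) t := by
  have key : HasDerivAt (fun u => ∑ a, ∑ b, M u a b * M u b a)
      (∑ a, ∑ b, (M' a b * M t b a + M t a b * M' b a)) t :=
    HasDerivAt.fun_sum fun a _ => HasDerivAt.fun_sum fun b _ => (h a b).mul (h b a)
  have hval : ∑ a, ∑ b, (M' a b * M t b a + M t a b * M' b a) = 2 * (M' * M t).trace := by
    have hsum : ∑ a, ∑ b, (M' a b * M t b a + M t a b * M' b a)
        = (M' * M t).trace + (M t * M').trace := by
      simp only [Matrix.trace, Matrix.diag_apply, Matrix.mul_apply, Finset.sum_add_distrib]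
    rw [hsum, Matrix.trace_mul_comm (M t), two_mul]
  rw [hval] at key
  simpa only [Matrix.trace, Matrix.diag_apply, Matrix.mul_apply] using key


open Finset in
/-- along a solution of the Schlesinger system
`(Aᵏ)′ = Σ_{i≠k} [Aⁱ, Aᵏ]·(λᵢ′ − λₖ′)/(λᵢ − λₖ)` on an interval `I ⊆ ℝ` (with
pairwise distinct poles `λᵢ`), the quantities `a_{kk} = tr((Aᵏ)²)` are conserved. -/
theorem schlesinger_conserves_akk
    (n : ℕ) (I : Set ℝ) (hI : Convex ℝ I)
    (lam lam' : Fin (n + 1) → ℝ → ℂ)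
    (hlam : ∀ i, ∀ t ∈ I, HasDerivAt (lam i) (lam' i t) t)
    (hdist : ∀ i k, i ≠ k → ∀ t ∈ I, lam i t ≠ lam k t)
    (A A' : Fin (n + 1) → ℝ → Matrix (Fin 2) (Fin 2) ℂ)
    (hAtr : ∀ k, ∀ t ∈ I, (A k t).trace = 0)
    (hderiv : ∀ k (a b : Fin 2), ∀ t ∈ I,
      HasDerivAt (fun u => A k u a b) (A' k t a b) t)
    (hSch : ∀ k, ∀ t ∈ I, A' k t =
      ∑ i ∈ univ.erase k,
        ((lam' i t - lam' k t) / (lam i t - lam k t)) •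
          (A i t * A k t - A k t * A i t)) :
    ∀ k, ∀ t₁ ∈ I, ∀ t₂ ∈ I,
      (A k t₁ * A k t₁).trace = (A k t₂ * A k t₂).trace := by
  intro k t₁ h₁ t₂ h₂
  have hconst : ∀ t ∈ I, HasDerivWithinAt (fun u => (A k u * A k u).trace) 0 I t := by
    intro t ht
    have hzero : (A' k t * A k t).trace = 0 := by
      rw [hSch k t ht, Matrix.sum_mul, Matrix.trace_sum]
      refine Finset.sum_eq_zero fun i _ => ?_
      rw [Matrix.smul_mul, Matrix.trace_smul, Matrix.trace_commutator_mul_self_s14, smul_zero]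
    have hd := Matrix.hasDerivAt_trace_mul_self fun a b => hderiv k a b t ht
    rw [hzero, mul_zero] at hd
    exact hd.hasDerivWithinAt
  have hle := hI.norm_image_sub_le_of_norm_hasDerivWithin_le (C := 0) hconst
    (fun t _ => norm_zero.le) h₂ h₁
  rw [zero_mul] at hle
  exact sub_eq_zero.mp (norm_le_zero_iff.mp hle)
end
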